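/- Let n, m ≥ 1 and let k_1,…,k_n be real constants. For i = 1,…,n, let ψ_i : ℝⁱ → ℝ be (n+m-i) times continuously differentiable with ψ_i(0) = 0. Define h_0 := 0 and, recursively for i = 1,…,n, h_i(y_1,…,y_i, s_0,…,s_{i-1}) := -k_i (y_i − h_{i-1}(y_1,…,y_{i-1}, s_0,…,s_{i-2}) − s_{i-1}) − ψ_i(y_1,…,y_i) + Σ_{k=1}^{i-1} [ (∂h_{i-1}/∂y_k)·(y_{k+1} + ψ_k(y_1,…,y_k)) + (∂h_{i-1}/∂s_{k-1})·s_k ]. Let s : ℝ → ℝ be n times continuously differentiable, v : ℝ → ℝ continuous, and Y = (y_1,…,y_n) : ℝ → ℝⁿ continuously differentiable satisfying ẏ_i(t) = y_{i+1}(t) + ψ_i(y_1(t),…,y_i(t)) for i = 1,…,n-1 and ẏ_n(t) = ψ_n(y_1(t),…,y_n(t)) + v(t). Define z_i(t) := y_i(t) − h_{i-1}(y_1(t),…,y_{i-1}(t), s(t),…,s^{(i-2)}(t)) − s^{(i-1)}(t) for i = 1,…,n. Then the z_i are differentiable and satisfy ż_i(t) = -k_i z_i(t) + z_{i+1}(t)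 for i = 1,…,n-1, and ż_n(t) = -k_n z_n(t) − h_n(Y(t), s(t),…,s^{(n-1)}(t)) − s^{(n)}(t) + v(t). -/

import Mathlib

open Set Finset

/-- Extension of a finite vector to a sequence, by zero. -/
noncomputable def extendFin (n : ℕ) (y : Fin n → ℝ) : ℕ → ℝ :=
  fun j => if h : j < n then y ⟨j, h⟩ else 0

/-- The recursively defined backstepping gain functions `h_i` (0-based data:
`k i` is the paper's `k_{i+1}`, `ψ i` is the paper's `ψ_{i+1}`; `hgain k ψ i` is
the paper's `h_i`). -/
noncomputable def hgain (k : ℕ → ℝ) (ψ : ℕ → (ℕ → ℝ) → ℝ) :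
    ℕ → (ℕ → ℝ) → (ℕ → ℝ) → ℝ
  | 0 => fun _ _ => 0
  | (i + 1) => fun y s =>
      -(k i) * (y i - hgain k ψ i y s - s i) - ψ i y
        + ∑ j ∈ Finset.range i,
            (deriv (fun a => hgain k ψ i (Function.update y j a) s) (y j)
                * (y (j + 1) + ψ j y)
              + deriv (fun a => hgain k ψ i y (Function.update s j a)) (s j)
                * s (j + 1))

lemma extendFin_of_lt {N j : ℕ} (h : j < N) (y : Fin N → ℝ) :
    extendFin N y j = y ⟨j, h⟩ := by
  simp [extendFin, h]

lemma update_extendFin {N j : ℕ} (h : j < N) (y : Fin N → ℝ) (a : ℝ) :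
    Function.update (extendFin N y) j a = extendFin N (Function.update y ⟨j, h⟩ a) := by
  funext l
  by_cases hl : l = j
  · subst hl
    simp [extendFin, h]
  · by_cases hlN : l < N <;> simp [extendFin, hl, hlN]

/-- `hgain k ψ i` only depends on the first `i` entries of each argument. -/
lemma hgain_congr {n : ℕ} (k : ℕ → ℝ) {ψ : ℕ → (ℕ → ℝ) → ℝ}
    (hψdep : ∀ i < n, ∀ y y' : ℕ → ℝ, (∀ j ≤ i, y j = y' j) → ψ i y = ψ i y')
    {i : ℕ} (hi : i ≤ n) {y y' s s' : ℕ → ℝ} (hy : ∀ j < i, y j = y' j)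
    (hs : ∀ j < i, s j = s' j) : hgain k ψ i y s = hgain k ψ i y' s' := by
  induction i generalizing y y' s s' with
  | zero => rfl
  | succ i ih =>
    have hupd : ∀ {x x' : ℕ → ℝ}, (∀ l < i + 1, x l = x' l) → ∀ j a,
        ∀ l < i, Function.update x j a l = Function.update x' j a l := by
      intro x x' hx j a l hl
      simp only [Function.update_apply, hx l (by omega)]
    have hy' : ∀ j < i, y j = y' j := fun j hj => hy j (by omega)
    have hs' : ∀ j < i, s j = s' j := fun j hj => hs j (by omega)
    simp only [hgain]
    rw [hy i (by omega), hs i (by omega), ih (by omega) hy' hs',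
      hψdep i (by omega) y y' fun j hj => hy j (by omega)]
    congr 1
    refine Finset.sum_congr rfl fun j hj => ?_
    rw [Finset.mem_range] at hj
    rw [hy j (by omega), hs j (by omega), hy (j + 1) (by omega), hs (j + 1) (by omega),
      hψdep j (by omega) y y' fun l hl => hy l (by omega),
      funext fun a => ih (by omega) (hupd hy j a) hs',
      funext fun a => ih (by omega) hy' (hupd hs j a)]

lemma hasDerivAt_update_fst {N : ℕ} {H : (ℕ → ℝ) → (ℕ → ℝ) → ℝ}
    {p : (Fin N → ℝ) × (Fin N → ℝ)}
    (hF : DifferentiableAt ℝ (fun p : (Fin N → ℝ) × (Fin N → ℝ) =>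
      H (extendFin N p.1) (extendFin N p.2)) p) {j : ℕ} (hj : j < N) :
    HasDerivAt (fun a => H (Function.update (extendFin N p.1) j a) (extendFin N p.2))
      (fderiv ℝ (fun p : (Fin N → ℝ) × (Fin N → ℝ) =>
        H (extendFin N p.1) (extendFin N p.2)) p (Pi.single ⟨j, hj⟩ 1, 0))
      (extendFin N p.1 j) := by
  simp only [update_extendFin hj, extendFin_of_lt hj]
  have hc : HasDerivAt (fun a => (Function.update p.1 ⟨j, hj⟩ a, p.2))
      ((Pi.single ⟨j, hj⟩ 1, 0) : (Fin N → ℝ) × (Fin N → ℝ)) (p.1 ⟨j, hj⟩) :=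
    (hasDerivAt_update p.1 ⟨j, hj⟩ _).prodMk (hasDerivAt_const _ _)
  exact HasFDerivAt.comp_hasDerivAt_of_eq _ hF.hasFDerivAt hc (by simp)

lemma hasDerivAt_update_snd {N : ℕ} {H : (ℕ → ℝ) → (ℕ → ℝ) → ℝ}
    {p : (Fin N → ℝ) × (Fin N → ℝ)}
    (hF : DifferentiableAt ℝ (fun p : (Fin N → ℝ) × (Fin N → ℝ) =>
      H (extendFin N p.1) (extendFin N p.2)) p) {j : ℕ} (hj : j < N) :
    HasDerivAt (fun a => H (extendFin N p.1) (Function.update (extendFin N p.2) j a))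
      (fderiv ℝ (fun p : (Fin N → ℝ) × (Fin N → ℝ) =>
        H (extendFin N p.1) (extendFin N p.2)) p (0, Pi.single ⟨j, hj⟩ 1))
      (extendFin N p.2 j) := by
  simp only [update_extendFin hj, extendFin_of_lt hj]
  have hc : HasDerivAt (fun a => (p.1, Function.update p.2 ⟨j, hj⟩ a))
      ((0, Pi.single ⟨j, hj⟩ 1) : (Fin N → ℝ) × (Fin N → ℝ)) (p.2 ⟨j, hj⟩) :=
    (hasDerivAt_const _ _).prodMk (hasDerivAt_update p.2 ⟨j, hj⟩ _)
  exact HasFDerivAt.comp_hasDerivAt_of_eq _ hF.hasFDerivAt hc (by simp)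

lemma contDiff_hgain {n m : ℕ} (hm : 1 ≤ m) (k : ℕ → ℝ) {ψ : ℕ → (ℕ → ℝ) → ℝ}
    (hψdep : ∀ i < n, ∀ y y' : ℕ → ℝ, (∀ j ≤ i, y j = y' j) → ψ i y = ψ i y')
    (hψsmooth : ∀ i < n, ContDiff ℝ ((n + m - i - 1 : ℕ) : ℕ∞)
      (fun y : Fin (i + 1) → ℝ => ψ i (extendFin (i + 1) y)))
    {N : ℕ} (hN : N ≤ n) {i : ℕ} (hi : i ≤ N) :
    ContDiff ℝ ((n + m - i : ℕ) : ℕ∞) (fun p : (Fin N → ℝ) × (Fin N → ℝ) =>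
      hgain k ψ i (extendFin N p.1) (extendFin N p.2)) := by
  induction i with
  | zero => exact contDiff_const
  | succ i ih =>
    have hF := ih (by omega)
    have hle : ((n + m - (i + 1) : ℕ) : ℕ∞) ≤ ((n + m - i : ℕ) : ℕ∞) := by
      exact_mod_cast (by omega : n + m - (i + 1) ≤ n + m - i)
    have hne : (((n + m - i : ℕ) : ℕ∞) : WithTop ℕ∞) ≠ 0 := by
      have : n + m - i ≠ 0 := by omega
      exact_mod_cast this
    have hψ : ∀ j ≤ i, ContDiff ℝ ((n + m - (i + 1) : ℕ) : ℕ∞)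
        (fun p : (Fin N → ℝ) × (Fin N → ℝ) => ψ j (extendFin N p.1)) := by
      intro j hj
      have hres : ContDiff ℝ ((n + m - (i + 1) : ℕ) : ℕ∞)
          (fun p : (Fin N → ℝ) × (Fin N → ℝ) =>
            (fun l : Fin (j + 1) => p.1 ⟨l, by omega⟩)) := by fun_prop
      have hsm : ContDiff ℝ ((n + m - (i + 1) : ℕ) : ℕ∞)
          (fun y : Fin (j + 1) → ℝ => ψ j (extendFin (j + 1) y)) :=
        (hψsmooth j (by omega)).of_le
          (by exact_mod_cast (by omega : n + m - (i + 1) ≤ n + m - j - 1))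
      convert hsm.comp hres using 1
      funext p
      refine hψdep j (by omega) _ _ fun l hl => ?_
      rw [extendFin_of_lt (by omega : l < N), extendFin_of_lt (by omega : l < j + 1)]
    have hcoord₁ : ∀ j < N, ContDiff ℝ ((n + m - (i + 1) : ℕ) : ℕ∞)
        (fun p : (Fin N → ℝ) × (Fin N → ℝ) => extendFin N p.1 j) := by
      intro j hj
      simp only [extendFin_of_lt hj]
      fun_prop
    have hcoord₂ : ∀ j < N, ContDiff ℝ ((n + m - (i + 1) : ℕ) : ℕ∞)
        (fun p : (Fin N → ℝ) × (Fin N → ℝ) => extendFin N p.2 j) := by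
      intro j hj
      simp only [extendFin_of_lt hj]
      fun_prop
    have hfderiv : ContDiff ℝ ((n + m - (i + 1) : ℕ) : ℕ∞)
        (fderiv ℝ (fun p : (Fin N → ℝ) × (Fin N → ℝ) =>
          hgain k ψ i (extendFin N p.1) (extendFin N p.2))) :=
      hF.fderiv_right (by exact_mod_cast (by omega : n + m - (i + 1) + 1 ≤ n + m - i))
    have hdiff := hF.differentiable hne
    have hF' := hF.of_le (WithTop.coe_le_coe.2 hle)
    simp only [hgain]
    refine ContDiff.add ((contDiff_const.mul
      (((hcoord₁ i (by omega)).sub hF').sub (hcoord₂ i (by omega)))).sub (hψ i le_rfl))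
      (ContDiff.sum fun j hj => ?_)
    rw [Finset.mem_range] at hj
    have hjN : j < N := by omega
    refine ContDiff.add (ContDiff.mul ?_ ((hcoord₁ (j + 1) (by omega)).add (hψ j hj.le)))
      (ContDiff.mul ?_ (hcoord₂ (j + 1) (by omega)))
    · simp only [fun p => (hasDerivAt_update_fst (hdiff p) hjN).deriv]
      exact hfderiv.clm_apply contDiff_const
    · simp only [fun p => (hasDerivAt_update_snd (hdiff p) hjN).deriv]
      exact hfderiv.clm_apply contDiff_const

/-- Chain rule for `hgain` along a pair of sequence-valued curves. -/
lemma hasDerivAt_hgain {n m : ℕ} (hm : 1 ≤ m) (k : ℕ → ℝ) {ψ : ℕ → (ℕ → ℝ) → ℝ}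
    (hψdep : ∀ i < n, ∀ y y' : ℕ → ℝ, (∀ j ≤ i, y j = y' j) → ψ i y = ψ i y')
    (hψsmooth : ∀ i < n, ContDiff ℝ ((n + m - i - 1 : ℕ) : ℕ∞)
      (fun y : Fin (i + 1) → ℝ => ψ i (extendFin (i + 1) y)))
    {i : ℕ} (hi : i ≤ n) {y s : ℕ → ℝ → ℝ} {y' s' : ℕ → ℝ} {t : ℝ}
    (hy : ∀ j < i, HasDerivAt (y j) (y' j) t) (hs : ∀ j < i, HasDerivAt (s j) (s' j) t) :
    HasDerivAt (fun t => hgain k ψ i (fun j => y j t) (fun j => s j t))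
      (∑ j ∈ Finset.range i,
        (deriv (fun a => hgain k ψ i (Function.update (fun l => y l t) j a)
            (fun l => s l t)) (y j t) * y' j
          + deriv (fun a => hgain k ψ i (fun l => y l t)
            (Function.update (fun l => s l t) j a)) (s j t) * s' j)) t := by
  have hdiff := (contDiff_hgain hm k hψdep hψsmooth hi (le_refl i)).differentiable
    (by have : n + m - i ≠ 0 := by omega
        exact_mod_cast this)
  set F := fun p : (Fin i → ℝ) × (Fin i → ℝ) =>
    hgain k ψ i (extendFin i p.1) (extendFin i p.2)
  let c : ℝ → (Fin i → ℝ) × (Fin i → ℝ) := fun t => (fun j => y j t, fun j => s j t)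
  have hc : HasDerivAt c (fun j => y' j, fun j => s' j) t :=
    (hasDerivAt_pi.2 fun j : Fin i => hy j j.2).prodMk
      (hasDerivAt_pi.2 fun j : Fin i => hs j j.2)
  have hcomp := (hdiff (c t)).hasFDerivAt.comp_hasDerivAt t hc
  have hext₁ : ∀ t, ∀ j < i, y j t = extendFin i (c t).1 j := fun t j hj => by
    rw [extendFin_of_lt hj]
  have hext₂ : ∀ t, ∀ j < i, s j t = extendFin i (c t).2 j := fun t j hj => by
    rw [extendFin_of_lt hj]
  have hupd : ∀ {x x' : ℕ → ℝ}, (∀ l < i, x l = x' l) → ∀ j a,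
      ∀ l < i, Function.update x j a l = Function.update x' j a l := by
    intro x x' hx j a l hl
    simp only [Function.update_apply, hx l hl]
  refine (hcomp.congr_deriv ?_).congr_of_eventuallyEq
    (Filter.Eventually.of_forall fun t => hgain_congr k hψdep hi (hext₁ t) (hext₂ t))
  have hdecomp : (((fun j => y' j), (fun j => s' j)) : (Fin i → ℝ) × (Fin i → ℝ)) =
      ∑ j : Fin i, (y' j • ((Pi.single j 1, 0) : (Fin i → ℝ) × (Fin i → ℝ))
        + s' j • ((0, Pi.single j 1) : (Fin i → ℝ) × (Fin i → ℝ))) := by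
    ext l <;> simp [Prod.fst_sum, Prod.snd_sum, Finset.sum_apply, Pi.single_apply]
  rw [hdecomp, map_sum, Finset.sum_range]
  refine Finset.sum_congr rfl fun j _ => ?_
  rw [map_add, map_smul, map_smul, smul_eq_mul, smul_eq_mul,
    funext fun a => hgain_congr k hψdep hi (hupd (hext₁ t) j a) (hext₂ t),
    funext fun a => hgain_congr k hψdep hi (hext₁ t) (hupd (hext₂ t) j a),
    hext₁ t j j.2, hext₂ t j j.2, (hasDerivAt_update_fst (hdiff (c t)) j.2).deriv,
    (hasDerivAt_update_snd (hdiff (c t)) j.2).deriv, mul_comm, mul_comm (s' j)]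

/-- Section 3.1: the forward nonovershooting backstepping
transformation `z_i = y_i − h_{i-1}(y, s,…,s^{(i-2)}) − s^{(i-1)}` maps the
strict-feedback plant `ẏ_i = y_{i+1} + ψ_i`, `ẏ_n = ψ_n + v` into the target
cascade `ż_i = -k_i z_i + z_{i+1}`, `ż_n = -k_n z_n − h_n − s^{(n)} + v`.
(All indices 0-based: `z i`, `y i` for `i = 0,…,n-1`.) -/
theorem stmt_9 (n m : ℕ) (hn : 1 ≤ n) (hm : 1 ≤ m) (k : ℕ → ℝ)
    (ψ : ℕ → (ℕ → ℝ) → ℝ)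
    (hψdep : ∀ i < n, ∀ y y' : ℕ → ℝ, (∀ j ≤ i, y j = y' j) → ψ i y = ψ i y')
    (hψsmooth : ∀ i < n, ContDiff ℝ ((n + m - i - 1 : ℕ) : ℕ∞)
      (fun y : Fin (i + 1) → ℝ => ψ i (extendFin (i + 1) y)))
    (hψ0 : ∀ i < n, ψ i 0 = 0)
    (s : ℝ → ℝ) (hs : ContDiff ℝ (n : ℕ∞) s)
    (v : ℝ → ℝ) (hv : Continuous v)
    (y : ℕ → ℝ → ℝ)
    (hode : ∀ i, i + 1 < n → ∀ t : ℝ,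
      HasDerivAt (y i) (y (i + 1) t + ψ i (fun j => y j t)) t)
    (hoden : ∀ t : ℝ,
      HasDerivAt (y (n - 1)) (ψ (n - 1) (fun j => y j t) + v t) t)
    (z : ℕ → ℝ → ℝ)
    (hz : ∀ i t, z i t = y i t
      - hgain k ψ i (fun j => y j t) (fun j => iteratedDeriv j s t)
      - iteratedDeriv i s t) :
    (∀ i, i + 1 < n → ∀ t : ℝ,
      HasDerivAt (z i) (-(k i) * z i t + z (i + 1) t) t) ∧
    (∀ t : ℝ, HasDerivAt (z (n - 1))
      (-(k (n - 1)) * z (n - 1) t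
        - hgain k ψ n (fun j => y j t) (fun j => iteratedDeriv j s t)
        - iteratedDeriv n s t + v t) t) := by
  have hsd : ∀ j < n, ∀ t, HasDerivAt (iteratedDeriv j s) (iteratedDeriv (j + 1) s t) t := by
    intro j hj t
    rw [iteratedDeriv_succ]
    exact (hs.differentiable_iteratedDeriv j (by exact_mod_cast hj) t).hasDerivAt
  have hgd : ∀ i < n, ∀ t, HasDerivAt
      (fun t => hgain k ψ i (fun j => y j t) (fun j => iteratedDeriv j s t))
      (hgain k ψ (i + 1) (fun j => y j t) (fun j => iteratedDeriv j s t)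
        + k i * z i t + ψ i (fun j => y j t)) t := by
    intro i hi t
    refine (hasDerivAt_hgain hm k hψdep hψsmooth hi.le
      (fun j hj => hode j (by omega) t) (fun j hj => hsd j (by omega) t)).congr_deriv ?_
    rw [hz, hgain]
    ring
  have hzd : ∀ i < n, ∀ t w, HasDerivAt (y i) w t → HasDerivAt (z i)
      (w - (hgain k ψ (i + 1) (fun j => y j t) (fun j => iteratedDeriv j s t)
        + k i * z i t + ψ i (fun j => y j t)) - iteratedDeriv (i + 1) s t) t := by
    intro i hi t w hw
    exact ((hw.sub (hgd i hi t)).sub (hsd i hi t)).congr_of_eventuallyEq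
      (Filter.Eventually.of_forall (hz i))
  refine ⟨fun i hi t => ?_, fun t => ?_⟩
  · refine (hzd i (by omega) t _ (hode i hi t)).congr_deriv ?_
    rw [hz (i + 1)]
    ring
  · refine (hzd (n - 1) (by omega) t _ (hoden t)).congr_deriv ?_
    rw [Nat.sub_add_cancel hn]
    ring
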